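/- arXiv:1509.08268 — 2 statements merged into one kernel-verified Lean document; each statement's English description precedes it below -/
import Mathlib

section
/- Let p be a prime, G a finite group, E a normal subgroup of G, and P a p-subgroup of G such that Q := P ∩ E is a Sylow p-subgroup of E and C_P(E) = 1. Let H := E ⋊ P be the external semidirect product for the conjugation action of P on E, and identify E with the subgroup E×1 of H. Let θ be a P-invariant irreducible complex character of E (that is, θ(x e x⁻¹) = θ(e) for all x ∈ P and e ∈ E). Then θ extends to an irreducible character of the subgroup EP of G if and only if there exists an irreducible character θ̃ of H extending θ (via the identification E ≅ E×1) such that the index in C_H(E×1) of the subgroup {c ∈ C_H(E×1) : θ̃(c) = θ̃(1)} is not divisible by p. -/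
open SemidirectProduct

/-- The conjugation action of a subgroup `P` on a normal subgroup `E`. -/
def conjAction {G : Type*} [Group G] (E P : Subgroup G) [E.Normal] : P →* MulAut E :=
  (MulAut.conjNormal (G := G) (H := E)).comp P.subtype

/-- `χ : K → ℂ` is an irreducible (complex) character of the finite group `K` if it is the
character of some simple finite-dimensional complex representation of `K`. -/
def IsIrreducibleCharacter (K : Type) [Group K] (χ : K → ℂ) : Prop :=
  ∃ V : FDRep ℂ K, CategoryTheory.Simple V ∧ χ = FDRep.character V

/-- A character inflated along a surjective homomorphism is irreducible if and only if the original
character is. -/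
theorem FDRep.simple_iff_of_character_eq_comp {H K : Type} [Group H] [Group K] [Finite H]
    (f : H →* K) (hf : Function.Surjective f) (V : FDRep ℂ K) (W : FDRep ℂ H)
    (h : ∀ x, W.character x = V.character (f x)) :
    CategoryTheory.Simple W ↔ CategoryTheory.Simple V := by
  classical
  have := Finite.of_surjective f hf
  have := Fintype.ofFinite H
  have := Fintype.ofFinite K
  have hfib : ∀ k : K, ({x : H | f x = k} : Finset H).card = Nat.card f.ker := by
    intro k
    rw [← Nat.card_congr (f.fiberEquivKerOfSurjective hf k), Nat.card_eq_fintype_card,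
      Fintype.card_ofFinset]
    congr 1
  have hsum : ∑ x : H, W.character x * W.character x⁻¹ =
      Nat.card f.ker * ∑ k : K, V.character k * V.character k⁻¹ := by
    rw [← Finset.sum_fiberwise (s := Finset.univ) (g := f), Finset.mul_sum]
    refine Finset.sum_congr rfl fun k _ => ?_
    rw [← hfib k, ← nsmul_eq_mul]
    refine Finset.sum_eq_card_nsmul fun x hx => ?_
    rw [h, h, map_inv, (Finset.mem_filter.mp hx).2]
  have hcard : Nat.card H = Nat.card f.ker * Nat.card K := by
    rw [← f.ker.card_mul_index, Subgroup.index_ker, f.range_eq_top.mpr hf, Subgroup.card_top]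
  have hne : (Nat.card f.ker : ℂ) ≠ 0 := Nat.cast_ne_zero.mpr Nat.card_pos.ne'
  rw [FDRep.simple_iff_char_is_norm_one, FDRep.simple_iff_char_is_norm_one, hsum, hcard,
    Nat.cast_mul, mul_right_inj' hne]

/-- Schur's lemma: a linear endomorphism commuting with a simple representation is a scalar. -/
theorem FDRep.exists_eq_smul_one_of_commute {K : Type} [Group K] (V : FDRep ℂ K)
    [CategoryTheory.Simple V] (T : V →ₗ[ℂ] V) (hT : ∀ g, Commute T (V.ρ g)) :
    ∃ c : ℂ, T = c • LinearMap.id := by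
  let F : V ⟶ V := ⟨CategoryTheory.InducedCategory.homMk (ModuleCat.ofHom T), fun g => by
    ext x
    exact LinearMap.congr_fun (hT g) x⟩
  obtain ⟨c, hc⟩ := CategoryTheory.endomorphism_simple_eq_smul_id ℂ F
  exact ⟨c, congrArg (fun f : V ⟶ V => f.hom.hom.hom) hc.symm⟩

/-- If the restriction of a representation along `ι` has an irreducible character, then an element
centralizing the image of `ι` on which the character takes its value at `1` acts trivially. -/
theorem FDRep.ρ_eq_one_of_character_eq {H K : Type} [Group H] [Group K] [Finite K]
    (ι : K →* H) (W : FDRep ℂ H) (hW : IsIrreducibleCharacter K fun k => W.character (ι k))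
    (h : H) (hcomm : ∀ k, Commute h (ι k)) (hχ : W.character h = W.character 1) :
    W.ρ h = 1 := by
  obtain ⟨V, hV, hVW⟩ := hW
  let U : FDRep ℂ K := FDRep.of (W.ρ.comp ι)
  have hU : CategoryTheory.Simple U :=
    (FDRep.simple_iff_of_character_eq_comp (MonoidHom.id K) Function.surjective_id V U
      fun k => congrFun hVW k).mpr hV
  obtain ⟨c, hc⟩ := FDRep.exists_eq_smul_one_of_commute U (W.ρ h) fun k =>
    (hcomm k).map W.ρ
  change W.ρ h = c • (LinearMap.id : W →ₗ[ℂ] W) at hc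
  have hne : (Module.finrank ℂ W : ℂ) ≠ 0 := by
    intro h0
    have h0' : Module.finrank ℂ U = 0 := Nat.cast_eq_zero.mp h0
    have : Subsingleton U := Module.finrank_zero_iff.mp h0'
    refine CategoryTheory.id_nonzero U ?_
    ext x
    exact Subsingleton.elim (α := U) _ _
  rw [FDRep.char_one, FDRep.character, hc, map_smul, LinearMap.trace_id, smul_eq_mul,
    mul_eq_right₀ hne] at hχ
  rw [hc, hχ, one_smul]
  rfl

/-- If `P ∩ E` is a Sylow `p`-subgroup of the normal subgroup `E` and `C_P(E) = 1`, then
`C_{EP}(E)` has order prime to `p`. -/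
theorem not_dvd_card_centralizer_inf_sup {p : ℕ} (hp : p.Prime) {G : Type*} [Group G] [Finite G]
    (E P : Subgroup G) [E.Normal] (hP : IsPGroup p P)
    (hQ : ∃ S : Sylow p E, (S : Subgroup E) = (P ⊓ E).subgroupOf E)
    (hC : Subgroup.centralizer (E : Set G) ⊓ P = ⊥) :
    ¬ p ∣ Nat.card ↥(Subgroup.centralizer (E : Set G) ⊓ (E ⊔ P)) := by
  have := Fact.mk hp
  have hindex : ¬ p ∣ (P.subgroupOf (E ⊔ P)).index := by
    obtain ⟨S, hS⟩ := hQ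
    have hEP : P.relIndex (E ⊔ P) = P.relIndex E := by
      have h1 := Subgroup.relIndex_mul_relIndex (P ⊓ E) P (E ⊔ P) inf_le_left le_sup_right
      have h2 := Subgroup.relIndex_mul_relIndex (P ⊓ E) E (E ⊔ P) inf_le_right le_sup_left
      rw [Subgroup.inf_relIndex_left, mul_comm] at h1
      rw [Subgroup.inf_relIndex_right, Subgroup.relIndex_sup_left] at h2
      rw [← h2] at h1
      exact Nat.eq_of_mul_eq_mul_right 
        (Nat.pos_of_ne_zero (Subgroup.index_ne_zero_of_finite (H := E.subgroupOf P))) h1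
    change ¬ p ∣ P.relIndex (E ⊔ P)
    rw [hEP, ← Subgroup.inf_relIndex_right, Subgroup.relIndex, ← hS]
    exact S.not_dvd_index
  have hPp : IsPGroup p (P.subgroupOf (E ⊔ P)) := hP.comap_subtype
  intro hdvd
  obtain ⟨⟨z, hzC, hzK⟩, hz⟩ := exists_prime_orderOf_dvd_card' p hdvd
  replace hz : orderOf z = p := (Subgroup.orderOf_coe _).trans hz
  let z' : ↥(E ⊔ P) := ⟨z, hzK⟩
  have hz' : IsPGroup p (Subgroup.zpowers z') :=
    IsPGroup.of_card (n := 1) (by rw [Nat.card_zpowers, Subgroup.orderOf_mk, hz, pow_one])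
  obtain ⟨T, hT⟩ := hz'.exists_le_sylow
  obtain ⟨g, hg⟩ := MulAction.exists_smul_eq ↥(E ⊔ P) T (hPp.toSylow hindex)
  have hmem : g * z' * g⁻¹ ∈ hPp.toSylow hindex := by
    rw [← hg]
    exact Subgroup.smul_mem_pointwise_smul z' (MulAut.conj g) _ (hT (Subgroup.mem_zpowers z'))
  have hbot : (g : G) * z * (g : G)⁻¹ ∈ Subgroup.centralizer (E : Set G) ⊓ P :=
    ⟨Subgroup.Normal.conj_mem inferInstance z hzC g, hmem⟩
  rw [hC, Subgroup.mem_bot, conj_eq_one_iff] at hbot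
  rw [hbot, orderOf_one] at hz
  exact hp.ne_one hz.symm

/-- The canonical homomorphism `E ⋊ P → EP`, `(e, x) ↦ e x`. -/
def conjActionToSup {G : Type*} [Group G] (E P : Subgroup G) [E.Normal] :
    E ⋊[conjAction E P] P →* ↥(E ⊔ P) :=
  SemidirectProduct.lift (Subgroup.inclusion le_sup_left) (Subgroup.inclusion le_sup_right)
    fun x => by
      ext e
      simp [conjAction, MulAut.conj_apply, MulAut.conjNormal_apply]

theorem coe_conjActionToSup {G : Type*} [Group G] (E P : Subgroup G) [E.Normal]
    (x : E ⋊[conjAction E P] P) : (conjActionToSup E P x : G) = x.left * x.right := rfl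

theorem conjActionToSup_surjective {G : Type*} [Group G] (E P : Subgroup G) [E.Normal] :
    Function.Surjective (conjActionToSup E P) := by
  rintro ⟨g, hg⟩
  obtain ⟨e, he, x, hx, rfl⟩ := Subgroup.mem_sup_of_normal_left.mp hg
  exact ⟨⟨⟨e, he⟩, ⟨x, hx⟩⟩, rfl⟩

/-- An element of `E ⋊ P` centralizes `E × 1` if and only if its image in `EP` centralizes `E`. -/
theorem mem_centralizer_range_inl_iff {G : Type*} [Group G] (E P : Subgroup G) [E.Normal]
    (x : E ⋊[conjAction E P] P) :
    x ∈ Subgroup.centralizer (Set.range (inl : E →* E ⋊[conjAction E P] P)) ↔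
      (conjActionToSup E P x : G) ∈ Subgroup.centralizer (E : Set G) := by
  simp only [Subgroup.mem_centralizer_iff, Set.forall_mem_range, SetLike.mem_coe,
    coe_conjActionToSup]
  constructor
  · intro h e he
    simpa [coe_conjActionToSup] using
      congrArg (fun y => (conjActionToSup E P y : G)) (h ⟨e, he⟩)
  · intro h e
    have he := h e e.2
    ext
    · simp only [mul_left, left_inl, right_inl, map_one, MulAut.one_apply, Subgroup.coe_mul]
      simp only [conjAction, MonoidHom.comp_apply, MulAut.conjNormal_apply, Subgroup.subtype_apply]
      rw [← mul_assoc, ← mul_assoc, eq_mul_inv_iff_mul_eq, mul_assoc, he]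
    · simp

theorem isPGroup_ker_conjActionToSup {p : ℕ} {G : Type*} [Group G] (E P : Subgroup G) [E.Normal]
    (hP : IsPGroup p P) : IsPGroup p (conjActionToSup E P).ker := by
  refine hP.of_injective (rightHom.comp (conjActionToSup E P).ker.subtype) ?_
  rw [injective_iff_map_eq_one]
  rintro ⟨x, hx⟩ (hr : x.right = 1)
  have hx' : (x.left : G) * x.right = 1 := congrArg Subtype.val hx
  rw [hr, Subgroup.coe_one, mul_one, OneMemClass.coe_eq_one] at hx'
  exact Subtype.ext (SemidirectProduct.ext hx' hr)

theorem stmt1 (p : ℕ) (hp : p.Prime) (G : Type) [Group G] [Finite G]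
    (E P : Subgroup G) [hE : E.Normal] (hP : IsPGroup p P)
    -- `Q := P ∩ E` is a Sylow `p`-subgroup of `E`
    (hQ : ∃ S : Sylow p E, (S : Subgroup E) = (P ⊓ E).subgroupOf E)
    -- `C_P(E) = 1`
    (hC : Subgroup.centralizer (E : Set G) ⊓ P = ⊥)
    -- `θ` is a `P`-invariant irreducible character of `E`
    (θ : E → ℂ) (hθ : IsIrreducibleCharacter E θ)
    (hinv : ∀ (x : P) (e : E),
      θ ⟨(x : G) * e * (x : G)⁻¹, hE.conj_mem e e.2 x⟩ = θ e) :
    -- `θ` extends to an irreducible character of `EP ≤ G` ↔ ...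
    (∃ χ : ↥(E ⊔ P) → ℂ, IsIrreducibleCharacter ↥(E ⊔ P) χ ∧
        ∀ e : E, χ ⟨(e : G), Subgroup.mem_sup_left e.2⟩ = θ e) ↔
      -- ... there is an irreducible character of `H = E ⋊ P` extending `θ` such that the
      -- index in `C_H(E×1)` of `{c ∈ C_H(E×1) : θ̃ c = θ̃ 1}` is not divisible by `p`.
      (∃ θt : E ⋊[conjAction E P] P → ℂ,
        IsIrreducibleCharacter (E ⋊[conjAction E P] P) θt ∧
        (∀ e : E, θt (inl e) = θ e) ∧
        ¬ p ∣ Nat.card (Subgroup.centralizer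
              (Set.range (inl : E →* E ⋊[conjAction E P] P) : Set (E ⋊[conjAction E P] P))) /
            Nat.card {c : Subgroup.centralizer
              (Set.range (inl : E →* E ⋊[conjAction E P] P) : Set (E ⋊[conjAction E P] P)) //
                θt c = θt 1}) := by
  have := Fact.mk hp
  set C := Subgroup.centralizer (Set.range (inl : E →* E ⋊[conjAction E P] P)) with hCdef
  have hsurj := conjActionToSup_surjective E P
  have : Finite (E ⋊[conjAction E P] P) := Finite.of_equiv _ equivProd.symm
  have hquot : ∀ W : FDRep ℂ (E ⋊[conjAction E P] P), (∀ e : E, W.character (inl e) = θ e) →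
      Nat.card C / Nat.card {c : C // W.character c = W.character 1} = W.ρ.ker.relIndex C := by
    intro W hW
    have hcard : Nat.card {c : C // W.character c = W.character 1} =
        Nat.card (W.ρ.ker.subgroupOf C) := by
      refine Nat.card_congr (Equiv.subtypeEquivRight fun c => ⟨fun hc => ?_, fun hc => ?_⟩)
      · exact FDRep.ρ_eq_one_of_character_eq inl W (by simpa only [hW] using hθ) c
          (fun e => (c.2 _ ⟨e, rfl⟩).symm) hc
      · have hc : W.ρ c = 1 := hc
        rw [FDRep.character, FDRep.character, hc, map_one W.ρ]
    rw [hcard, ← (W.ρ.ker.subgroupOf C).card_mul_index, Nat.mul_div_cancel_left _ Nat.card_pos,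
      Subgroup.relIndex]
  constructor
  · rintro ⟨_, ⟨V, hV, rfl⟩, hVθ⟩
    let W : FDRep ℂ (E ⋊[conjAction E P] P) := FDRep.of (V.ρ.comp (conjActionToSup E P))
    have hWV : ∀ x, W.character x = V.character (conjActionToSup E P x) := fun _ => rfl
    have hWθ : ∀ e : E, W.character (inl e) = θ e := by
      intro e
      rw [hWV, ← hVθ, conjActionToSup, lift_inl]
      rfl
    refine ⟨W.character, ⟨W, (FDRep.simple_iff_of_character_eq_comp _ hsurj V W hWV).mpr hV, rfl⟩,
      hWθ, ?_⟩
    rw [hquot W hWθ]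
    intro hdvd
    refine not_dvd_card_centralizer_inf_sup hp E P hP hQ hC (hdvd.trans ?_)
    have hker : (conjActionToSup E P).ker ≤ W.ρ.ker := by
      intro x hx
      change V.ρ (conjActionToSup E P x) = 1
      rw [hx, map_one]
    refine (Subgroup.relIndex_dvd_of_le_left C hker).trans ?_
    rw [Subgroup.relIndex_ker, ← Subgroup.card_map_of_injective (E ⊔ P).subtype_injective]
    refine Subgroup.card_dvd_of_le ?_
    rintro _ ⟨_, ⟨x, hx, rfl⟩, rfl⟩
    exact ⟨(mem_centralizer_range_inl_iff E P x).mp hx, SetLike.coe_mem _⟩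
  · rintro ⟨_, ⟨W, hW, rfl⟩, hWθ, hdvd⟩
    rw [hquot W hWθ] at hdvd
    have hker : (conjActionToSup E P).ker ≤ W.ρ.ker := by
      intro x hx
      have hxC : x ∈ C := by
        rw [hCdef, mem_centralizer_range_inl_iff, show conjActionToSup E P x = 1 from hx]
        exact one_mem _
      obtain ⟨k, hk⟩ := isPGroup_ker_conjActionToSup E P hP ⟨x, hx⟩
      have hxk : x ^ p ^ k = 1 := congrArg Subtype.val hk
      have hxn : x ^ W.ρ.ker.relIndex C ∈ W.ρ.ker :=
        Subgroup.pow_index_mem (W.ρ.ker.subgroupOf C) ⟨x, hxC⟩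
      have hcop : (W.ρ.ker.relIndex C).Coprime (p ^ k) :=
        ((Nat.Prime.coprime_iff_not_dvd hp).mpr hdvd).symm.pow_right k
      have h1 : orderOf (W.ρ x) ∣ 1 := by
        rw [← hcop]
        refine Nat.dvd_gcd (orderOf_dvd_of_pow_eq_one ?_) (orderOf_dvd_of_pow_eq_one ?_)
        · rw [← map_pow]; exact hxn
        · rw [← map_pow, hxk, map_one]
      exact orderOf_eq_one_iff.mp (Nat.dvd_one.mp h1)
    let V : FDRep ℂ ↥(E ⊔ P) := FDRep.of ((QuotientGroup.lift _ W.ρ hker).comp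
      (QuotientGroup.quotientKerEquivOfSurjective _ hsurj).symm.toMonoidHom)
    have hWV : ∀ x, W.character x = V.character (conjActionToSup E P x) := by
      intro x
      change _ = LinearMap.trace ℂ W (QuotientGroup.lift _ W.ρ hker
        ((QuotientGroup.quotientKerEquivOfSurjective _ hsurj).symm (conjActionToSup E P x)))
      have : (QuotientGroup.quotientKerEquivOfSurjective _ hsurj).symm (conjActionToSup E P x) =
          (x : _ ⧸ (conjActionToSup E P).ker) := by
        rw [MulEquiv.symm_apply_eq]
        rfl
      rw [this]
      rfl
    refine ⟨V.character, ⟨V, (FDRep.simple_iff_of_character_eq_comp _ hsurj V W hWV).mp hW, rfl⟩,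
      fun e => ?_⟩
    rw [← hWθ, hWV, conjActionToSup, lift_inl]
    rfl
end

section
/- Let p be a prime, G a finite group, E a normal subgroup of G, and P a p-subgroup of G such that Q := P ∩ E is a Sylow p-subgroup of E and C_P(E) = 1. Let H := E ⋊ P be the external semidirect product for the conjugation action of P on E, and set ΔQ := {(x,x⁻¹) : x ∈ Q}. Then (ΔQ)(1×P) ∩ C_H(E×1) = ΔQ, and ΔQ is a Sylow p-subgroup of the centralizer C_H(E×1). -/
open SemidirectProduct
open scoped Pointwise

/-- The element `(x, x⁻¹)` of `E ⋊ P`, for `x ∈ Q = P ∩ E`. -/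
def deltaEl {G : Type*} [Group G] (E P : Subgroup G) [E.Normal] (x : ↥(P ⊓ E)) :
    E ⋊[conjAction E P] P :=
  ⟨⟨(x : G), x.2.2⟩, (⟨(x : G), x.2.1⟩ : P)⁻¹⟩

open Subgroup

/-- A normal subgroup meets any subgroup `S` in a subgroup whose index in the normal subgroup
divides the index of `S`. -/
theorem Subgroup.relIndex_dvd_index_of_normal_right {H : Type*} [Group H] [Finite H]
    (S N : Subgroup H) [N.Normal] : S.relIndex N ∣ S.index := by
  have h₁ := relIndex_mul_relIndex (S ⊓ N) S (S ⊔ N) inf_le_left le_sup_left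
  have h₂ := relIndex_mul_relIndex (S ⊓ N) N (S ⊔ N) inf_le_right le_sup_right
  rw [inf_relIndex_left] at h₁
  rw [inf_relIndex_right, relIndex_sup_right, ← h₁, mul_comm] at h₂
  have h₃ : S.relIndex N = S.relIndex (S ⊔ N) :=
    Nat.eq_of_mul_eq_mul_left (Nat.pos_of_ne_zero (N.subgroupOf S).index_ne_zero_of_finite) h₂
  exact h₃ ▸ relIndex_dvd_index_of_le le_sup_left

section ConjSemidirect

variable {G : Type*} [Group G] (E P : Subgroup G) [E.Normal]

@[simp]
theorem coe_conjAction_apply (x : P) (e : E) :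
    (conjAction E P x e : G) = x * e * (x : G)⁻¹ := rfl

/-- The centralizer of `E × 1` consists of the pairs whose product in `G` centralizes `E`. -/
theorem mem_centralizer_range_inl_iff_s5 (z : E ⋊[conjAction E P] P) :
    z ∈ centralizer (Set.range (inl : E →* E ⋊[conjAction E P] P)) ↔
      (z.left * z.right : G) ∈ centralizer (E : Set G) := by
  simp only [mem_centralizer_iff, Set.forall_mem_range, SetLike.mem_coe]
  constructor
  · intro h f hf
    have := congrArg (fun w : E ⋊[conjAction E P] P => (w.left : G)) (h ⟨f, hf⟩)
    simp only [mul_left, left_inl, right_inl, map_one, MulAut.one_apply, coe_mul,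
      coe_conjAction_apply] at this
    rw [← mul_assoc, this]
    group
  · intro h f
    ext
    · simp only [mul_left, left_inl, right_inl, map_one, MulAut.one_apply, coe_mul,
        coe_conjAction_apply]
      have := h f f.2
      rw [← mul_assoc, ← eq_mul_inv_iff_mul_eq] at this
      rw [this]
      group
    · simp

instance normal_centralizer_range_inl :
    (centralizer (Set.range (inl : E →* E ⋊[conjAction E P] P))).Normal := by
  have : (inl : E →* E ⋊[conjAction E P] P).range.Normal := by
    rw [range_inl_eq_ker_rightHom]
    infer_instance
  rw [← MonoidHom.coe_range]
  infer_instance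

/-- The subgroup `(P ∩ E) ⋊ P` of `E ⋊ P`. -/
def leftMem : Subgroup (E ⋊[conjAction E P] P) where
  carrier := {z | (z.left : G) ∈ P}
  one_mem' := P.one_mem
  mul_mem' {a b} ha hb :=
    P.mul_mem ha (P.mul_mem (P.mul_mem a.right.2 hb) (P.inv_mem a.right.2))
  inv_mem' {a} ha := by
    simp only [Set.mem_ofPred_eq, inv_left, coe_conjAction_apply, coe_inv, inv_inv]
    exact P.mul_mem (P.mul_mem (P.inv_mem a.right.2) (P.inv_mem ha)) a.right.2

theorem mem_leftMem {z : E ⋊[conjAction E P] P} : z ∈ leftMem E P ↔ (z.left : G) ∈ P := Iff.rfl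

theorem index_leftMem [Finite G] : (leftMem E P).index = ((P ⊓ E).subgroupOf E).index := by
  have hcard : Nat.card (leftMem E P) = Nat.card ((P ⊓ E).subgroupOf E) * Nat.card P := by
    rw [← Nat.card_prod]
    exact Nat.card_congr
      { toFun := fun z => (⟨z.1.left, z.2, z.1.left.2⟩, z.1.right)
        invFun := fun y => ⟨⟨y.1.1, y.2⟩, y.1.2.1⟩
        left_inv := fun _ => rfl
        right_inv := fun _ => rfl }
  have : Finite (E ⋊[conjAction E P] P) := Finite.of_equiv _ equivProd.symm
  have h := (leftMem E P).card_mul_index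
  rw [SemidirectProduct.card, ← ((P ⊓ E).subgroupOf E).card_mul_index, hcard,
    mul_right_comm] at h
  exact Nat.eq_of_mul_eq_mul_left Nat.card_pos
    (Nat.eq_of_mul_eq_mul_right (Nat.card_pos (α := P)) (by rw [mul_right_comm, ← h]; ring))

theorem range_deltaEl_mul_range_inr :
    Set.range (deltaEl E P) * Set.range (inr : P →* E ⋊[conjAction E P] P) = leftMem E P := by
  ext z
  rw [Set.mem_mul, SetLike.mem_coe, mem_leftMem]
  constructor
  · rintro ⟨_, ⟨x, rfl⟩, _, ⟨y, rfl⟩, rfl⟩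
    simpa [deltaEl] using x.2.1
  · intro hz
    refine ⟨_, ⟨⟨z.left, hz, z.left.2⟩, rfl⟩, _, ⟨⟨z.left, hz⟩ * z.right, rfl⟩, ?_⟩
    ext <;> simp [deltaEl]

theorem leftMem_inf_centralizer_eq_range_deltaEl
    (hC : centralizer (E : Set G) ⊓ P = ⊥) :
    ((leftMem E P ⊓ centralizer (Set.range (inl : E →* E ⋊[conjAction E P] P)) :
      Subgroup (E ⋊[conjAction E P] P)) : Set (E ⋊[conjAction E P] P)) =
      Set.range (deltaEl E P) := by
  ext z
  rw [SetLike.mem_coe, mem_inf, mem_leftMem, mem_centralizer_range_inl_iff_s5]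
  constructor
  · rintro ⟨hz, hc⟩
    have h₁ : (z.left * z.right : G) ∈ centralizer (E : Set G) ⊓ P :=
      ⟨hc, P.mul_mem hz z.right.2⟩
    rw [hC, mem_bot] at h₁
    refine ⟨⟨z.left, hz, z.left.2⟩, ?_⟩
    ext
    · rfl
    · simpa [deltaEl] using inv_eq_of_mul_eq_one_right h₁
  · rintro ⟨x, rfl⟩
    refine ⟨x.2.1, ?_⟩
    simp [deltaEl, one_mem]

/-- `ΔQ` is a `p`-group because it embeds in `P` by projection. -/
theorem isPGroup_of_coe_eq_range_deltaEl {p : ℕ} (hP : IsPGroup p P)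
    {D : Subgroup (E ⋊[conjAction E P] P)}
    (hD : (D : Set (E ⋊[conjAction E P] P)) = Set.range (deltaEl E P)) : IsPGroup p D := by
  refine hP.of_injective (rightHom.comp D.subtype) ((injective_iff_map_eq_one _).2 ?_)
  rintro ⟨z, hz⟩ h
  obtain ⟨x, rfl⟩ : z ∈ Set.range (deltaEl E P) := hD ▸ hz
  have hx : x = 1 := Subtype.ext <| inv_eq_one.1 (congrArg Subtype.val h)
  subst hx
  exact Subtype.ext (SemidirectProduct.ext rfl inv_one)

end ConjSemidirect

theorem stmt5 (p : ℕ) (hp : p.Prime) (G : Type*) [Group G] [Finite G]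
    (E P : Subgroup G) [E.Normal] (hP : IsPGroup p P)
    -- `Q := P ∩ E` is a Sylow `p`-subgroup of `E`
    (hQ : ∃ S : Sylow p E, (S : Subgroup E) = (P ⊓ E).subgroupOf E)
    -- `C_P(E) = 1`
    (hC : Subgroup.centralizer (E : Set G) ⊓ P = ⊥) :
    -- `(ΔQ)(1×P) ∩ C_H(E×1) = ΔQ`
    (Set.range (deltaEl E P) * Set.range (inr : P →* E ⋊[conjAction E P] P)) ∩
        (Subgroup.centralizer (Set.range (inl : E →* E ⋊[conjAction E P] P)) :
          Set (E ⋊[conjAction E P] P)) =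
      Set.range (deltaEl E P) ∧
    -- and `ΔQ` is a Sylow `p`-subgroup of `C_H(E×1)`
    ∃ T : Sylow p (Subgroup.centralizer
        (Set.range (inl : E →* E ⋊[conjAction E P] P))),
      (((T : Subgroup (Subgroup.centralizer
            (Set.range (inl : E →* E ⋊[conjAction E P] P)))).map
          (Subgroup.centralizer
            (Set.range (inl : E →* E ⋊[conjAction E P] P))).subtype :
          Subgroup (E ⋊[conjAction E P] P)) : Set (E ⋊[conjAction E P] P)) =
        Set.range (deltaEl E P) := by
  have hD := leftMem_inf_centralizer_eq_range_deltaEl E P hC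
  refine ⟨by rw [range_deltaEl_mul_range_inr, ← coe_inf, hD], ?_⟩
  have : Fact p.Prime := ⟨hp⟩
  have : Finite (E ⋊[conjAction E P] P) := Finite.of_equiv _ equivProd.symm
  obtain ⟨S, hS⟩ := hQ
  set C := centralizer (Set.range (inl : E →* E ⋊[conjAction E P] P))
  have hp_group : IsPGroup p ((leftMem E P).subgroupOf C) :=
    ((isPGroup_of_coe_eq_range_deltaEl E P hP hD).comap_of_injective C.subtype
      C.subtype_injective).to_le fun z hz => ⟨hz, z.2⟩
  have h_index : ¬ p ∣ ((leftMem E P).subgroupOf C).index := fun h =>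
    S.not_dvd_index <| by
      rw [hS, ← index_leftMem]
      exact h.trans (relIndex_dvd_index_of_normal_right _ C)
  refine ⟨hp_group.toSylow h_index, ?_⟩
  rw [IsPGroup.toSylow_coe, subgroupOf_map_subtype, hD]
end
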